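/- For the partial harmonic sum, sum over n from 1 to N of 1/n = ln N + gamma + 1/(2N) + O(1/N^2), where gamma is the Euler-Mascheroni constant; consequently, over F_q[t], the product over monic irreducibles P of degree at most N of (1 - 1/|P|)^{-1} equals e^{gamma} * N * ln q * (1 + O(1/N)) up to the normalization by base-q logarithm (Mertens-type theorem for F_q[t]). -/

import Mathlib

open Real

/-- Harmonic sum as Mathlib's `harmonic`. -/
lemma aux_harm (N : ℕ) : ((harmonic N : ℚ) : ℝ) = ∑ n ∈ Finset.Icc 1 N, (1 : ℝ) / n := by
  rw [harmonic_eq_sum_Icc]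
  push_cast
  simp

lemma aux_log_step (n : ℝ) (hn : 1 ≤ n) :
    Real.log (n + 1) - Real.log n ≤ (1 / n + 1 / (n + 1)) / 2 ∧
    (1 / n + 1 / (n + 1)) / 2 - (1 / n ^ 2 - 1 / (n + 1) ^ 2) ≤
      Real.log (n + 1) - Real.log n := by
  have h0 : 0 < n := by linarith
  have e : Real.log (n + 1) - Real.log n = Real.log (1 + 1 / n) := by
    rw [← Real.log_div (by positivity) (by positivity)]
    congr 1
    field_simp
  rw [e]
  constructor
  · have h1 : 0 ≤ Real.log (1 + 1 / n) := by
      apply Real.log_nonneg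
      have : 0 < 1 / n := by positivity
      linarith
    have h2 := Real.self_le_sinh_iff.2 h1
    rw [Real.sinh_eq, Real.exp_neg, Real.exp_log (by positivity)] at h2
    refine h2.trans (le_of_eq ?_)
    field_simp
    ring
  · refine le_trans ?_ (Real.le_log_one_add_of_nonneg (x := 1 / n) (by positivity))
    have : (2 * (1 / n) / (1 / n + 2)) - ((1 / n + 1 / (n + 1)) / 2 - (1 / n ^ 2 - 1 / (n + 1) ^ 2))
        = (2 * (2 * n + 1) ^ 2 - n * (n + 1)) / (2 * n ^ 2 * (n + 1) ^ 2 * (2 * n + 1)) := by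
      field_simp
      ring
    have h3 : 0 ≤ (2 * (2 * n + 1) ^ 2 - n * (n + 1)) /
        (2 * n ^ 2 * (n + 1) ^ 2 * (2 * n + 1)) := by
      apply div_nonneg
      · nlinarith
      · positivity
    linarith

lemma aux_harmonic_bound (N : ℕ) (hN : 1 ≤ N) :
    -(1 / (N : ℝ) ^ 2) ≤ (∑ n ∈ Finset.Icc 1 N, (1 : ℝ) / n)
      - (Real.log N + Real.eulerMascheroniConstant + 1 / (2 * N)) ∧
    (∑ n ∈ Finset.Icc 1 N, (1 : ℝ) / n)
      - (Real.log N + Real.eulerMascheroniConstant + 1 / (2 * N)) ≤ 0 := by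
  set a : ℕ → ℝ := fun n => (harmonic (n + 1) : ℝ) - Real.log ((n + 1 : ℕ) : ℝ)
    - (1 / 2) * (1 / ((n : ℝ) + 1)) with ha
  set b : ℕ → ℝ := fun n => a n + (1 / ((n : ℝ) + 1)) * (1 / ((n : ℝ) + 1)) with hb
  have t0 : Filter.Tendsto (fun n : ℕ => 1 / ((n : ℝ) + 1)) Filter.atTop (nhds 0) :=
    tendsto_one_div_add_atTop_nhds_zero_nat
  have ta : Filter.Tendsto a Filter.atTop (nhds Real.eulerMascheroniConstant) := by
    have h1 := (Filter.tendsto_add_atTop_iff_nat 1).2 Real.tendsto_harmonic_sub_log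
    have h2 := h1.sub (t0.const_mul (1 / 2))
    rw [mul_zero, sub_zero] at h2
    exact h2
  have tb : Filter.Tendsto b Filter.atTop (nhds Real.eulerMascheroniConstant) := by
    have h2 := ta.add (t0.mul t0)
    rw [mul_zero, add_zero] at h2
    exact h2
  have step : ∀ n : ℕ, a (n + 1) - a n = (1 / ((n : ℝ) + 1) + 1 / ((n : ℝ) + 1 + 1)) / 2 -
      (Real.log ((n : ℝ) + 1 + 1) - Real.log ((n : ℝ) + 1)) := by
    intro n
    simp only [ha]
    rw [harmonic_succ (n + 1)]
    push_cast
    ring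
  have ma : Monotone a := by
    refine monotone_nat_of_le_succ fun n => ?_
    have := (aux_log_step ((n : ℝ) + 1) (by linarith [n.cast_nonneg (α := ℝ)])).1
    have := step n
    linarith
  have mb : Antitone b := by
    refine antitone_nat_of_succ_le fun n => ?_
    have h1 := (aux_log_step ((n : ℝ) + 1) (by linarith [n.cast_nonneg (α := ℝ)])).2
    have h2 := step n
    have e1 : b (n + 1) - b n = (a (n + 1) - a n) -
        (1 / ((n : ℝ) + 1) ^ 2 - 1 / ((n : ℝ) + 1 + 1) ^ 2) := by
      simp only [hb]
      push_cast
      field_simp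
      ring
    linarith
  obtain ⟨m, rfl⟩ : ∃ m, N = m + 1 := ⟨N - 1, by omega⟩
  have h1 := ma.ge_of_tendsto ta m
  have h2 := mb.le_of_tendsto tb m
  rw [← aux_harm]
  simp only [hb, ha] at h1 h2
  have e2 : 1 / (2 * ((m + 1 : ℕ) : ℝ)) = (1 / 2) * (1 / ((m : ℝ) + 1)) := by
    push_cast
    field_simp
  have e3 : 1 / (((m + 1 : ℕ) : ℝ)) ^ 2 = (1 / ((m : ℝ) + 1)) * (1 / ((m : ℝ) + 1)) := by
    push_cast
    field_simp
  rw [e2, e3]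
  constructor <;> linarith

lemma aux_log_tail (x : ℝ) (h0 : 0 ≤ x) (h1 : x ≤ 1 / 2) (K : ℕ) :
    ∑ k ∈ Finset.range K, x ^ (k + 1) / ((k : ℝ) + 1) ≤ -Real.log (1 - x) ∧
    -Real.log (1 - x) ≤ ∑ k ∈ Finset.range K, x ^ (k + 1) / ((k : ℝ) + 1) +
      2 * x ^ (K + 1) / ((K : ℝ) + 1) := by
  have hs := Real.hasSum_pow_div_log_of_abs_lt_one (x := x) (by rw [abs_of_nonneg h0]; linarith)
  constructor
  · exact sum_le_hasSum _ (fun i _ => by positivity) hs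
  · have ht := (hasSum_nat_add_iff' K).2 hs
    have hg := ((hasSum_geometric_of_lt_one h0 (by linarith)).mul_left
      (x ^ (K + 1) / ((K : ℝ) + 1)))
    have hle := hasSum_le (fun i => ?_) ht hg
    · have h3 : (1 - x)⁻¹ ≤ 2 := by
        rw [inv_le_comm₀ (by linarith) (by norm_num)]
        linarith
      have h4 : x ^ (K + 1) / ((K : ℝ) + 1) * (1 - x)⁻¹ ≤ x ^ (K + 1) / ((K : ℝ) + 1) * 2 :=
        mul_le_mul_of_nonneg_left h3 (by positivity)
      have h5 : x ^ (K + 1) / ((K : ℝ) + 1) * 2 = 2 * x ^ (K + 1) / ((K : ℝ) + 1) := by ring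
      linarith
    · rw [div_mul_eq_mul_div, ← pow_add, show i + K + 1 = K + 1 + i by ring]
      apply div_le_div_of_nonneg_left (by positivity) (by positivity)
      push_cast
      linarith [i.cast_nonneg (α := ℝ)]

/-- Gauss: the degrees of monic irreducibles of degree dividing `n` sum to `q ^ n`. -/
lemma aux_gauss (F : Type*) [Field F] [Fintype F] (q : ℕ)
    (hq : Fintype.card F = q) (n : ℕ) (hn : n ≠ 0) :
    ∃ T : Finset (Polynomial F),
      (∀ p, p ∈ T ↔ p.Monic ∧ Irreducible p ∧ p.natDegree ∣ n) ∧
      ∑ p ∈ T, p.natDegree = q ^ n := by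
  classical
  have hq1 : 1 < q := hq ▸ Fintype.one_lt_card
  have hc : Nat.card F = q := by rw [Nat.card_eq_fintype_card, hq]
  set f : Polynomial F := Polynomial.X ^ q ^ n - Polynomial.X with hf
  have hf0 : f ≠ 0 := FiniteField.X_pow_card_pow_sub_X_ne_zero _ hn hq1
  have hdeg : f.natDegree = q ^ n := FiniteField.X_pow_card_pow_sub_X_natDegree_eq _ hn hq1
  obtain ⟨p, hp⟩ := CharP.exists F
  have hpq : p ∣ q := by
    rw [← CharP.cast_eq_zero_iff F p, ← hq]
    exact FiniteField.cast_card_eq_zero F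
  have hsq : Squarefree f :=
    (galois_poly_separable p (q ^ n) (dvd_pow hpq hn)).squarefree
  have hnd := (UniqueFactorizationMonoid.squarefree_iff_nodup_normalizedFactors hf0).1 hsq
  refine ⟨(UniqueFactorizationMonoid.normalizedFactors f).toFinset, fun P => ?_, ?_⟩
  · rw [Multiset.mem_toFinset, Polynomial.mem_normalizedFactors_iff hf0]
    constructor
    · rintro ⟨h1, h2, h3⟩
      exact ⟨h2, h1, h1.natDegree_dvd_iff_dvd_X_pow_card_pow_sub_X.2 (by rwa [hc])⟩
    · rintro ⟨h1, h2, h3⟩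
      exact ⟨h2, h1, by
        have := h2.natDegree_dvd_iff_dvd_X_pow_card_pow_sub_X.1 h3
        rwa [hc] at this⟩
  · have h1 := UniqueFactorizationMonoid.prod_normalizedFactors hf0
    have h2 := Polynomial.natDegree_eq_of_degree_eq (Polynomial.degree_eq_degree_of_associated h1)
    rw [hdeg, Polynomial.natDegree_multiset_prod _
      (UniqueFactorizationMonoid.zero_notMem_normalizedFactors f)] at h2
    rw [← h2, Finset.sum, Multiset.toFinset_val, hnd.dedup]

lemma aux_reindex (N : ℕ) (g : ℕ → ℕ → ℝ) :
    ∑ d ∈ Finset.Icc 1 N, ∑ k ∈ Finset.range (N / d), g d (d * (k + 1)) =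
      ∑ n ∈ Finset.Icc 1 N, ∑ d ∈ n.divisors, g d n := by
  rw [Finset.sum_sigma', Finset.sum_sigma']
  refine Finset.sum_bij' (fun x _ => ⟨x.1 * (x.2 + 1), x.1⟩) (fun y _ => ⟨y.2, y.1 / y.2 - 1⟩)
    ?_ ?_ ?_ ?_ ?_
  · rintro ⟨d, k⟩ h
    simp only [Finset.mem_sigma, Finset.mem_Icc, Finset.mem_range, Nat.mem_divisors] at h ⊢
    obtain ⟨⟨h1, h2⟩, h3⟩ := h
    have h4 : (k + 1) * d ≤ N := (Nat.le_div_iff_mul_le h1).1 h3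
    have h5 : 0 < d * (k + 1) := Nat.mul_pos h1 (Nat.succ_pos k)
    rw [mul_comm] at h4
    exact ⟨⟨h5, h4⟩, dvd_mul_right _ _, h5.ne'⟩
  · rintro ⟨n, d⟩ h
    simp only [Finset.mem_sigma, Finset.mem_Icc, Finset.mem_range, Nat.mem_divisors] at h ⊢
    obtain ⟨⟨h1, h2⟩, h3, h4⟩ := h
    have h5 : 0 < d := Nat.pos_of_dvd_of_pos h3 h1
    have h6 : d ≤ n := Nat.le_of_dvd h1 h3
    have h7 : 0 < n / d := Nat.div_pos h6 h5
    have h8 : n / d ≤ N / d := Nat.div_le_div_right h2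
    omega
  · rintro ⟨d, k⟩ h
    simp only [Finset.mem_sigma, Finset.mem_Icc] at h
    have h1 : 0 < d := h.1.1
    simp [Nat.mul_div_cancel_left _ h1]
  · rintro ⟨n, d⟩ h
    simp only [Finset.mem_sigma, Finset.mem_Icc, Nat.mem_divisors] at h
    obtain ⟨⟨h1, h2⟩, h3, h4⟩ := h
    have h5 : 0 < d := Nat.pos_of_dvd_of_pos h3 h1
    have h7 : 0 < n / d := Nat.div_pos (Nat.le_of_dvd h1 h3) h5
    have h8 : d * (n / d - 1 + 1) = n := by
      rw [Nat.sub_add_cancel h7, Nat.mul_div_cancel' h3]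
    simp [h8]
  · rintro ⟨d, k⟩ h
    rfl

/-- The analytic part: weights `c` satisfying Gauss' identity. -/
lemma aux_sum_bound (q : ℕ) (hq : 2 ≤ q) (N : ℕ) (hN : 1 ≤ N) (c : ℕ → ℕ)
    (hc : ∀ n, 1 ≤ n → n ≤ N → ∑ d ∈ n.divisors, c d * d = q ^ n) :
    (∑ n ∈ Finset.Icc 1 N, (1 : ℝ) / n) ≤
      ∑ d ∈ Finset.Icc 1 N, (c d : ℝ) * -Real.log (1 - 1 / (q : ℝ) ^ d) ∧
    ∑ d ∈ Finset.Icc 1 N, (c d : ℝ) * -Real.log (1 - 1 / (q : ℝ) ^ d) ≤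
      (∑ n ∈ Finset.Icc 1 N, (1 : ℝ) / n) + 2 / N := by
  have hq' : (2 : ℝ) ≤ q := by exact_mod_cast hq
  have hq0 : (0 : ℝ) < q := by linarith
  have hN0 : (0 : ℝ) < N := by exact_mod_cast hN
  have hmain : ∑ d ∈ Finset.Icc 1 N, (c d : ℝ) *
      ∑ k ∈ Finset.range (N / d), (1 / (q : ℝ) ^ d) ^ (k + 1) / ((k : ℝ) + 1) =
      ∑ n ∈ Finset.Icc 1 N, (1 : ℝ) / n := by
    have h := aux_reindex N (fun d n => ((c d * d : ℕ) : ℝ) * (1 / ((q : ℝ) ^ n * n)))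
    trans ∑ n ∈ Finset.Icc 1 N, ∑ d ∈ n.divisors, ((c d * d : ℕ) : ℝ) * (1 / ((q : ℝ) ^ n * n))
    · rw [← h]
      refine Finset.sum_congr rfl fun d hd => ?_
      rw [Finset.mul_sum]
      refine Finset.sum_congr rfl fun k _ => ?_
      have hd0 : (d : ℝ) ≠ 0 := by
        have := (Finset.mem_Icc.1 hd).1
        positivity
      rw [div_pow, one_pow, ← pow_mul]
      push_cast
      field_simp
    · refine Finset.sum_congr rfl fun n hn => ?_
      have hn' := Finset.mem_Icc.1 hn
      rw [← Finset.sum_mul, ← Nat.cast_sum, hc n hn'.1 hn'.2]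
      have hd0 : (n : ℝ) ≠ 0 := by
        have := hn'.1
        positivity
      push_cast
      field_simp
  have hx : ∀ d ∈ Finset.Icc 1 N, 0 ≤ 1 / (q : ℝ) ^ d ∧ 1 / (q : ℝ) ^ d ≤ 1 / 2 := by
    intro d hd
    refine ⟨by positivity, ?_⟩
    apply div_le_div_of_nonneg_left (by norm_num) (by norm_num)
    have h1 : (q : ℝ) ^ 1 ≤ (q : ℝ) ^ d :=
      pow_le_pow_right₀ (by linarith) (Finset.mem_Icc.1 hd).1
    rw [pow_one] at h1
    linarith
  constructor
  · rw [← hmain]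
    refine Finset.sum_le_sum fun d hd => ?_
    exact mul_le_mul_of_nonneg_left (aux_log_tail _ (hx d hd).1 (hx d hd).2 _).1 (by positivity)
  · have hgeo : ∑ d ∈ Finset.Icc 1 N, ((1 : ℝ) / 2) ^ d ≤ 1 := by
      have : ∀ M : ℕ, ∑ d ∈ Finset.Icc 1 M, ((1 : ℝ) / 2) ^ d = 1 - (1 / 2) ^ M := by
        intro M
        induction M with
        | zero => simp
        | succ m ih =>
          rw [Finset.sum_Icc_succ_top (by omega), ih, pow_succ]
          ring
      rw [this]
      have : (0 : ℝ) ≤ (1 / 2) ^ N := by positivity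
      linarith
    have hterm : ∀ d ∈ Finset.Icc 1 N, (c d : ℝ) * -Real.log (1 - 1 / (q : ℝ) ^ d) ≤
        (c d : ℝ) * (∑ k ∈ Finset.range (N / d), (1 / (q : ℝ) ^ d) ^ (k + 1) / ((k : ℝ) + 1)) +
          2 / N * (1 / 2) ^ d := by
      intro d hd
      have hd' := Finset.mem_Icc.1 hd
      have h1 := mul_le_mul_of_nonneg_left (aux_log_tail _ (hx d hd).1 (hx d hd).2 (N / d)).2
        (Nat.cast_nonneg (α := ℝ) (c d))
      rw [mul_add] at h1
      refine h1.trans (add_le_add le_rfl ?_)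
      have hd0 : (0 : ℝ) < d := by exact_mod_cast hd'.1
      have hcd : (c d : ℝ) * d ≤ (q : ℝ) ^ d := by
        have h2 := hc d hd'.1 hd'.2
        have h3 : c d * d ≤ ∑ e ∈ d.divisors, c e * e :=
          Finset.single_le_sum (f := fun e => c e * e) (fun _ _ => Nat.zero_le _)
            (Nat.mem_divisors_self d (by omega))
        rw [h2] at h3
        exact_mod_cast h3
      have hK : (N : ℝ) ≤ d * (((N / d : ℕ) : ℝ) + 1) := by
        have := (Nat.lt_mul_div_succ N (b := d) hd'.1).le
        exact_mod_cast this
      have hK1 : 1 ≤ N / d := Nat.div_pos hd'.2 hd'.1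
      set x : ℝ := 1 / (q : ℝ) ^ d with hxd
      have hx1 : x ≤ 1 := (hx d hd).2.trans (by norm_num)
      have hx0 : 0 ≤ x := (hx d hd).1
      have hxK : x ^ (N / d + 1) ≤ x ^ 2 := pow_le_pow_of_le_one hx0 hx1 (by omega)
      have hx2 : x ≤ (1 / 2) ^ d := by
        rw [hxd, div_pow, one_pow]
        apply div_le_div_of_nonneg_left (by norm_num) (by positivity)
        exact pow_le_pow_left₀ (by norm_num) hq' d
      have hqx : (q : ℝ) ^ d * x = 1 := by
        rw [hxd]
        field_simp
      calc (c d : ℝ) * (2 * x ^ (N / d + 1) / (((N / d : ℕ) : ℝ) + 1))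
          = ((c d : ℝ) * d) * (2 * x ^ (N / d + 1)) / (d * (((N / d : ℕ) : ℝ) + 1)) := by
            field_simp
        _ ≤ ((q : ℝ) ^ d) * (2 * x ^ 2) / N := by
            gcongr
        _ = 2 / N * x := by
            rw [show (q : ℝ) ^ d * (2 * x ^ 2) = 2 * x * ((q : ℝ) ^ d * x) by ring, hqx]
            ring
        _ ≤ 2 / N * (1 / 2) ^ d := by gcongr
    refine (Finset.sum_le_sum hterm).trans ?_
    rw [Finset.sum_add_distrib, hmain, ← Finset.mul_sum]
    have : (2 : ℝ) / N * ∑ d ∈ Finset.Icc 1 N, ((1 : ℝ) / 2) ^ d ≤ 2 / N * 1 := by gcongr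
    linarith

/-- The logarithm of the Mertens product. -/
lemma aux_prod (F : Type*) [Field F] [Fintype F] (q : ℕ)
    (hq : Fintype.card F = q) (N : ℕ) (hN : 1 ≤ N) :
    ∃ L : ℝ, (∏ᶠ P ∈ {p : Polynomial F | p.Monic ∧ Irreducible p ∧ p.natDegree ≤ N},
              (1 - 1 / (q : ℝ) ^ P.natDegree)⁻¹) = Real.exp L ∧
      (∑ n ∈ Finset.Icc 1 N, (1 : ℝ) / n) ≤ L ∧
      L ≤ (∑ n ∈ Finset.Icc 1 N, (1 : ℝ) / n) + 2 / N := by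
  classical
  have hq1 : 1 < q := hq ▸ Fintype.one_lt_card
  have hq' : (1 : ℝ) < q := by exact_mod_cast hq1
  obtain ⟨T, hT, -⟩ := aux_gauss F q hq N.factorial (Nat.factorial_ne_zero N)
  set S := T.filter (fun p => p.natDegree ≤ N) with hS
  have hmem : ∀ p, p ∈ S ↔ p.Monic ∧ Irreducible p ∧ p.natDegree ≤ N := by
    intro p
    rw [hS, Finset.mem_filter, hT]
    constructor
    · rintro ⟨⟨h1, h2, -⟩, h3⟩
      exact ⟨h1, h2, h3⟩
    · rintro ⟨h1, h2, h3⟩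
      exact ⟨⟨h1, h2, Nat.dvd_factorial h2.natDegree_pos h3⟩, h3⟩
  set c : ℕ → ℕ := fun d => (S.filter (fun p => p.natDegree = d)).card with hcdef
  have hc : ∀ n, 1 ≤ n → n ≤ N → ∑ d ∈ n.divisors, c d * d = q ^ n := by
    intro n hn1 hn2
    obtain ⟨U, hU, hUs⟩ := aux_gauss F q hq n (by omega)
    rw [← hUs]
    have hmaps : ∀ p ∈ U, p.natDegree ∈ n.divisors := by
      intro p hp
      exact Nat.mem_divisors.2 ⟨((hU p).1 hp).2.2, by omega⟩
    rw [← Finset.sum_fiberwise_of_maps_to hmaps]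
    refine Finset.sum_congr rfl fun d hd => ?_
    have hdn := (Nat.mem_divisors.1 hd).1
    have hfe : U.filter (fun p => p.natDegree = d) = S.filter (fun p => p.natDegree = d) := by
      ext p
      simp only [Finset.mem_filter, hU, hmem]
      constructor
      · rintro ⟨⟨h1, h2, h3⟩, h4⟩
        exact ⟨⟨h1, h2, (Nat.le_of_dvd (by omega) h3).trans hn2⟩, h4⟩
      · rintro ⟨⟨h1, h2, h3⟩, h4⟩
        exact ⟨⟨h1, h2, h4 ▸ hdn⟩, h4⟩
    rw [hfe, Finset.sum_congr rfl (fun p hp => (Finset.mem_filter.1 hp).2), Finset.sum_const,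
      smul_eq_mul]
  have hb := aux_sum_bound q hq1 N hN c hc
  refine ⟨_, ?_, hb.1, hb.2⟩
  have hset : {p : Polynomial F | p.Monic ∧ Irreducible p ∧ p.natDegree ≤ N} = (S : Set _) := by
    ext p
    simp [hmem]
  rw [hset]
  rw [finprod_mem_coe_finset]
  have hmaps : ∀ p ∈ S, p.natDegree ∈ Finset.Icc 1 N := by
    intro p hp
    have := (hmem p).1 hp
    exact Finset.mem_Icc.2 ⟨this.2.1.natDegree_pos, this.2.2⟩
  rw [Real.exp_sum, ← Finset.prod_fiberwise_of_maps_to hmaps]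
  refine Finset.prod_congr rfl fun d hd => ?_
  rw [Finset.prod_congr rfl (g := fun _ => (1 - 1 / (q : ℝ) ^ d)⁻¹)
    (fun p hp => by rw [(Finset.mem_filter.1 hp).2]), Finset.prod_const]
  have hpos : 0 < 1 - 1 / (q : ℝ) ^ d := by
    rw [sub_pos, div_lt_one (by positivity)]
    exact one_lt_pow₀ hq' (by have := (Finset.mem_Icc.1 hd).1; omega)
  rw [Real.exp_nat_mul, Real.exp_neg, Real.exp_log hpos]

theorem harmonic_and_mertens_Fq (F : Type*) [Field F] [Fintype F] (q : ℕ)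
    (hq : Fintype.card F = q) :
    ∃ C : ℝ, 0 < C ∧
      (∀ N : ℕ, 1 ≤ N →
        |(∑ n ∈ Finset.Icc 1 N, (1 : ℝ) / n)
            - (Real.log N + Real.eulerMascheroniConstant + 1 / (2 * N))|
          ≤ C / N ^ 2) ∧
      (∀ N : ℕ, 1 ≤ N →
        |(∏ᶠ P ∈ {p : Polynomial F | p.Monic ∧ Irreducible p ∧ p.natDegree ≤ N},
              (1 - 1 / (q : ℝ) ^ P.natDegree)⁻¹)
            / (Real.exp Real.eulerMascheroniConstant * N) - 1|
          ≤ C / N) := by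
  have hexp : (1 : ℝ) ≤ Real.exp 3 := Real.one_le_exp (by norm_num)
  refine ⟨3 * Real.exp 3, by positivity, fun N hN => ?_, fun N hN => ?_⟩
  · obtain ⟨h1, h2⟩ := aux_harmonic_bound N hN
    have hN0 : (0 : ℝ) < N := by exact_mod_cast hN
    rw [abs_of_nonpos h2]
    have : (1 : ℝ) / (N : ℝ) ^ 2 ≤ 3 * Real.exp 3 / (N : ℝ) ^ 2 := by
      gcongr
      linarith
    linarith
  · have hN0 : (0 : ℝ) < N := by exact_mod_cast hN
    have hN1 : (1 : ℝ) ≤ N := by exact_mod_cast hN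
    obtain ⟨L, hL, h1, h2⟩ := aux_prod F q hq N hN
    obtain ⟨-, h3⟩ := aux_harmonic_bound N hN
    have h4 := Real.eulerMascheroniConstant_lt_eulerMascheroniSeq' N
    rw [Real.eulerMascheroniSeq', if_neg (by omega), aux_harm] at h4
    rw [hL]
    set y : ℝ := L - Real.log N - Real.eulerMascheroniConstant with hy
    have hy0 : 0 ≤ y := by linarith
    have e1 : 1 / (2 * (N : ℝ)) ≤ 1 / N := by
      apply div_le_div_of_nonneg_left (by norm_num) hN0
      linarith
    have e2 : (1 : ℝ) / N + 2 / N = 3 / N := by ring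
    have hy1 : y ≤ 3 / N := by linarith
    have hy2 : y ≤ 3 := hy1.trans (div_le_self (by norm_num) hN1)
    have he : Real.exp L / (Real.exp Real.eulerMascheroniConstant * N) = Real.exp y := by
      rw [hy, Real.exp_sub, Real.exp_sub, Real.exp_log hN0]
      field_simp
    rw [he, abs_of_nonneg (by linarith [Real.add_one_le_exp y])]
    have h5 : Real.exp y - 1 ≤ y * Real.exp y := by
      have h6 := Real.add_one_le_exp (-y)
      have h7 : Real.exp (-y) * Real.exp y = 1 := by rw [← Real.exp_add]; simp
      nlinarith [Real.exp_pos y]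
    calc Real.exp y - 1 ≤ y * Real.exp y := h5
      _ ≤ 3 / N * Real.exp 3 := by gcongr
      _ = 3 * Real.exp 3 / N := by ring
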